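/- For every w ∈ (0,1), the operator norm of the 2×2 complex matrix w·H + (1−w)·σ_x is strictly less than 1, where H is the Hadamard matrix and σ_x the Pauli x-matrix. -/

import Mathlib

open Matrix

/-- The operator norm of a matrix acting on Euclidean space (ℓ² norm). -/
noncomputable def opNorm {m : Type*} [Fintype m] [DecidableEq m]
    (A : Matrix m m ℂ) : ℝ :=
  ‖Matrix.toEuclideanCLM (𝕜 := ℂ) A‖

/-- The 2×2 Hadamard matrix. -/
noncomputable def Had : Matrix (Fin 2) (Fin 2) ℂ :=
  ((1 / Real.sqrt 2 : ℝ) : ℂ) • !![1, 1; 1, -1]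

/-- The Pauli x-matrix. -/
def pauliX : Matrix (Fin 2) (Fin 2) ℂ := !![0, 1; 1, 0]

/-- The C⋆-identity for the operator norm when `Aᴴ * A` is a scalar matrix. -/
theorem opNorm_mul_self_of_conjTranspose_mul_self_eq_smul_one {m : Type*} [Fintype m]
    [DecidableEq m] [Nonempty m] {A : Matrix m m ℂ} {c : ℂ} (h : Aᴴ * A = c • 1) :
    opNorm A * opNorm A = ‖c‖ := by
  rw [opNorm, ← CStarRing.norm_star_mul_self, ← map_star, ← map_mul, star_eq_conjTranspose, h,
    map_smul, map_one, norm_smul, norm_one, mul_one]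

/-- The matrix `w·H + (1−w)·σ_x` is a scalar multiple of a unitary matrix. -/
theorem conjTranspose_mul_self_hadamard_pauliX_combination (w : ℝ) :
    ((w : ℂ) • Had + ((1 - w : ℝ) : ℂ) • pauliX)ᴴ *
        ((w : ℂ) • Had + ((1 - w : ℝ) : ℂ) • pauliX) =
      ((w ^ 2 + (1 - w) ^ 2 + √2 * (w * (1 - w)) : ℝ) : ℂ) • 1 := by
  have hs : ((√2 : ℝ) : ℂ) ^ 2 = 2 := by
    exact_mod_cast Real.sq_sqrt (zero_le_two (α := ℝ))
  have hs0 : ((√2 : ℝ) : ℂ) ≠ 0 := by simp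
  ext i j
  fin_cases i <;> fin_cases j <;>
    simp [Had, pauliX, Matrix.mul_apply, Fin.sum_univ_two] <;> field_simp <;> grind

/-- For every `w ∈ (0,1)`, the operator norm of `w·H + (1−w)·σ_x` is strictly
less than `1`. -/
theorem opNorm_hadamard_pauliX_combination_lt_one {w : ℝ} (hw : w ∈ Set.Ioo (0 : ℝ) 1) :
    opNorm ((w : ℂ) • Had + ((1 - w : ℝ) : ℂ) • pauliX) < 1 := by
  obtain ⟨hw0, hw1⟩ := hw
  have hp : 0 < w * (1 - w) := mul_pos hw0 (sub_pos.2 hw1)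
  have hs : √2 < 2 := by rw [Real.sqrt_lt' two_pos]; norm_num
  have hmul := opNorm_mul_self_of_conjTranspose_mul_self_eq_smul_one
    (conjTranspose_mul_self_hadamard_pauliX_combination w)
  rw [Complex.norm_of_nonneg (by positivity)] at hmul
  nlinarith [mul_lt_mul_of_pos_right hs hp]
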